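/- arXiv:2203.07175 — 2 statements merged into one kernel-verified Lean document; each statement's English description precedes it below -/
import Mathlib

section
/- Let Ω ⊂ ℝᵈ be a bounded measurable set, g : ℝᵈ → ℝ a continuously differentiable function, and V : ℝᵈ → ℝᵈ a continuously differentiable vector field with compact support. Then the function t ↦ ∫_{(I + tV)(Ω)} g(y) dy is differentiable at t = 0 with derivative ∫_Ω ( g(x) · div V(x) + ⟨∇g(x), V(x)⟩ ) dx = ∫_Ω div( g·V )(x) dx. -/
open MeasureTheory
open scoped RealInnerProductSpace

namespace ContinuousLinearMap

variable {E : Type*} [NormedAddCommGroup E] [NormedSpace ℝ E] [FiniteDimensional ℝ E]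

/-- The determinant is a smooth function on the endomorphisms of a finite-dimensional space. -/
theorem contDiff_det {n : WithTop ℕ∞} : ContDiff ℝ n (fun A : E →L[ℝ] E => A.det) := by
  classical
  let b := Module.finBasis ℝ E
  have key : (fun A : E →L[ℝ] E => A.det) =
      fun A => ∑ σ : Equiv.Perm (Fin (Module.finrank ℝ E)), (Equiv.Perm.sign σ : ℤ) *
        ∏ i, b.repr (A (b i)) (σ i) := by
    funext A
    rw [ContinuousLinearMap.det, ← LinearMap.det_toMatrix b, Matrix.det_apply']
    simp [LinearMap.toMatrix_apply]
  rw [key]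
  refine ContDiff.sum fun σ _ => contDiff_const.mul (contDiff_prod fun i _ => ?_)
  let L : (E →L[ℝ] E) →ₗ[ℝ] ℝ :=
    { toFun := fun A => b.repr (A (b i)) (σ i)
      map_add' := by simp
      map_smul' := by simp }
  exact (LinearMap.toContinuousLinearMap L).contDiff

theorem hasDerivAt_det_one_add_smul (A : E →L[ℝ] E) :
    HasDerivAt (fun t : ℝ => (1 + t • A).det) (LinearMap.trace ℝ E A) 0 := by
  classical
  let b := Module.finBasis ℝ E
  set M := LinearMap.toMatrix b b (A : E →ₗ[ℝ] E) with hM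
  have key : (fun t : ℝ => (1 + t • A).det) = fun t => 1 + M.trace * t +
      (Matrix.det (1 + (Polynomial.X : Polynomial ℝ) •
        M.map Polynomial.C)).divX.divX.eval t * t ^ 2 := by
    funext t
    rw [← Matrix.det_one_add_smul, ContinuousLinearMap.det, ← LinearMap.det_toMatrix b, hM]
    simp [LinearMap.toMatrix_one]
  rw [key, LinearMap.trace_eq_matrix_trace ℝ b, ← hM]
  have h := (((hasDerivAt_id (0 : ℝ)).const_mul M.trace).const_add 1).add
    (((Matrix.det (1 + (Polynomial.X : Polynomial ℝ) •
        M.map Polynomial.C)).divX.divX.hasDerivAt 0).mul ((hasDerivAt_id (0 : ℝ)).pow 2))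
  simpa using! h

end ContinuousLinearMap

section

variable {E : Type*} [NormedAddCommGroup E] [InnerProductSpace ℝ E] [FiniteDimensional ℝ E]

theorem trace_fderiv_smul_eq {g : E → ℝ} {V : E → E} {x : E} (hg : DifferentiableAt ℝ g x)
    (hV : DifferentiableAt ℝ V x) :
    LinearMap.trace ℝ E (fderiv ℝ (fun y => g y • V y) x : E →ₗ[ℝ] E) =
      g x * LinearMap.trace ℝ E (fderiv ℝ V x : E →ₗ[ℝ] E) + ⟪gradient g x, V x⟫ := by
  rw [fderiv_fun_smul hg hV]
  have h : ((g x • fderiv ℝ V x + (fderiv ℝ g x).smulRight (V x) : E →L[ℝ] E) : E →ₗ[ℝ] E) =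
      g x • (fderiv ℝ V x : E →ₗ[ℝ] E) +
        ((fderiv ℝ g x : E →L[ℝ] ℝ) : E →ₗ[ℝ] ℝ).smulRight (V x) := rfl
  rw [h, map_add, map_smul, smul_eq_mul, LinearMap.trace_smulRight, inner_gradient_left]
  rfl

end

theorem injective_add_smul_of_lipschitzWith {E : Type*} [NormedAddCommGroup E] [NormedSpace ℝ E]
    {V : E → E} {C : NNReal} (hV : LipschitzWith C V) {t : ℝ} (ht : |t| * C < 1) :
    Function.Injective (fun x => x + t • V x) := by
  intro x y hxy
  have h : x - y = t • (V y - V x) := by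
    rw [smul_sub, sub_eq_sub_iff_add_eq_add]
    simpa [add_comm] using hxy
  have h1 : ‖x - y‖ ≤ |t| * C * ‖x - y‖ := by
    calc ‖x - y‖ = |t| * ‖V y - V x‖ := by rw [h, norm_smul, Real.norm_eq_abs]
      _ ≤ |t| * (C * ‖x - y‖) := by
        gcongr
        rw [norm_sub_rev x y]
        exact hV.norm_sub_le y x
      _ = _ := by ring
  have h2 : ‖x - y‖ = 0 := by nlinarith [norm_nonneg (x - y)]
  exact sub_eq_zero.1 (norm_eq_zero.1 h2)

/-- The derivative at `t = 0` of the integral of `g` over the image of a bounded measurable set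
under the perturbation of identity `I + t V`. -/
theorem hasDerivAt_integral_image_add_smul {E : Type*} [NormedAddCommGroup E]
    [InnerProductSpace ℝ E] [FiniteDimensional ℝ E] [MeasurableSpace E] [BorelSpace E] {Ω : Set E}
    (hΩm : MeasurableSet Ω) (hΩb : Bornology.IsBounded Ω) {g : E → ℝ} (hg : ContDiff ℝ 1 g)
    {V : E → E} (hV : ContDiff ℝ 1 V) (hVc : HasCompactSupport V) :
    HasDerivAt (fun t : ℝ => ∫ y in (fun x => x + t • V x) '' Ω, g y)
      (∫ x in Ω, g x * LinearMap.trace ℝ E (fderiv ℝ V x : E →ₗ[ℝ] E) + ⟪gradient g x, V x⟫) 0 := by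
  have hgd : Differentiable ℝ g := hg.differentiable one_ne_zero
  have hVd : Differentiable ℝ V := hV.differentiable one_ne_zero
  have hK : IsCompact (closure Ω) := hΩb.isCompact_closure
  have hΩK : Ω ⊆ closure Ω := subset_closure
  have cV : Continuous V := hV.continuous
  have cA : Continuous (fderiv ℝ V) := hV.continuous_fderiv one_ne_zero
  have cg : Continuous g := hg.continuous
  have cg' : Continuous (fderiv ℝ g) := hg.continuous_fderiv one_ne_zero
  have hdet : ContDiff ℝ 1 (fun A : E →L[ℝ] E => A.det) := ContinuousLinearMap.contDiff_det
  have cdet := hdet.continuous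
  have cdet' := hdet.continuous_fderiv one_ne_zero
  let D : (E →L[ℝ] E) → ℝ := fun A => A.det
  let F : ℝ → E → ℝ := fun t x => D (1 + t • fderiv ℝ V x) * g (x + t • V x)
  let F' : ℝ → E → ℝ := fun t x =>
    fderiv ℝ D (1 + t • fderiv ℝ V x) (fderiv ℝ V x) * g (x + t • V x) +
      D (1 + t • fderiv ℝ V x) * fderiv ℝ g (x + t • V x) (V x)
  have cF : Continuous (fun p : ℝ × E => F p.1 p.2) := by
    have : Continuous (fun p : ℝ × E => 1 + p.1 • fderiv ℝ V p.2) := by fun_prop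
    exact (cdet.comp this).mul (by fun_prop)
  have cF' : Continuous (fun p : ℝ × E => F' p.1 p.2) := by
    have : Continuous (fun p : ℝ × E => 1 + p.1 • fderiv ℝ V p.2) := by fun_prop
    have h2 : Continuous (fun p : ℝ × E => p.2 + p.1 • V p.2) := by fun_prop
    exact (((cdet'.comp this).clm_apply (cA.comp continuous_snd)).mul (cg.comp h2)).add
      ((cdet.comp this).mul ((cg'.comp h2).clm_apply (cV.comp continuous_snd)))
  have hdA : ∀ t x, HasDerivAt (fun t : ℝ => D (1 + t • fderiv ℝ V x))
      (fderiv ℝ D (1 + t • fderiv ℝ V x) (fderiv ℝ V x)) t := fun t x => by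
    have h1 : HasDerivAt (fun t : ℝ => 1 + t • fderiv ℝ V x) (fderiv ℝ V x) t := by
      simpa only [id, one_smul] using! ((hasDerivAt_id t).smul_const (fderiv ℝ V x)).const_add 1
    exact ((hdet.differentiable one_ne_zero) _).hasFDerivAt.comp_hasDerivAt t h1
  have hdF : ∀ t x, HasDerivAt (F · x) (F' t x) t := fun t x => by
    have h2 : HasDerivAt (fun t : ℝ => x + t • V x) (V x) t := by
      simpa only [id, one_smul] using! ((hasDerivAt_id t).smul_const (V x)).const_add x
    exact (hdA t x).mul ((hgd _).hasFDerivAt.comp_hasDerivAt t h2)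
  have hF'0 : ∀ x, F' 0 x = g x * LinearMap.trace ℝ E (fderiv ℝ V x : E →ₗ[ℝ] E) +
      ⟪gradient g x, V x⟫ := fun x => by
    have h1 := (hdA 0 x).unique
      (ContinuousLinearMap.hasDerivAt_det_one_add_smul (fderiv ℝ V x))
    have h3 : D 1 = 1 := by simp [D, ContinuousLinearMap.det]
    simp only [zero_smul, add_zero] at h1
    simp only [F', h1, zero_smul, add_zero, h3, one_mul, inner_gradient_left, mul_comm]
  obtain ⟨M, hM⟩ := ((isCompact_closedBall (0 : ℝ) 1).prod hK).exists_bound_of_continuousOn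
    cF'.continuousOn
  have hmain := (hasDerivAt_integral_of_dominated_loc_of_deriv_le (μ := volume.restrict Ω)
    (F := F) (F' := F') (x₀ := 0) (bound := fun _ => M)
    (Metric.closedBall_mem_nhds (0 : ℝ) one_pos)
    (.of_forall fun t => (cF.comp (.prodMk_right t)).aestronglyMeasurable)
    (((cF.comp (.prodMk_right 0)).continuousOn.integrableOn_compact hK).mono_set hΩK)
    (cF'.comp (.prodMk_right 0)).aestronglyMeasurable
    ((ae_restrict_iff' hΩm).2 (.of_forall fun x hx t ht => hM (t, x) ⟨ht, hΩK hx⟩))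
    (integrableOn_const (hΩb.measure_lt_top.ne))
    (.of_forall fun x t _ => hdF t x)).2
  simp only [hF'0] at hmain
  refine hmain.congr_of_eventuallyEq ?_
  have hpos : ∀ᶠ t in nhds (0 : ℝ), ∀ x ∈ closure Ω, 0 < D (1 + t • fderiv ℝ V x) := by
    refine hK.eventually_forall_of_forall_eventually fun x _ => ?_
    have c : Continuous (fun p : ℝ × E => D (1 + p.1 • fderiv ℝ V p.2)) :=
      cdet.comp (by fun_prop)
    refine c.continuousAt.eventually (lt_mem_nhds ?_)
    simp [D, ContinuousLinearMap.det]
  obtain ⟨C, hC⟩ := hV.lipschitzWith_of_hasCompactSupport hVc one_ne_zero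
  have hinj : ∀ᶠ t : ℝ in nhds 0, |t| * C < 1 := by
    refine ContinuousAt.eventually_lt (by fun_prop) continuousAt_const ?_
    simp
  filter_upwards [hpos, hinj] with t h1 h2
  rw [integral_image_eq_integral_abs_det_fderiv_smul volume hΩm (f := fun x => x + t • V x)
    (f' := fun x => 1 + t • fderiv ℝ V x)
    (fun x _ => ((hasFDerivAt_id x).add ((hVd x).hasFDerivAt.const_smul t)).hasFDerivWithinAt)
    (injective_add_smul_of_lipschitzWith hC h2).injOn]
  refine setIntegral_congr_fun hΩm fun x hx => ?_
  have := h1 x (hΩK hx)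
  simp only [F, smul_eq_mul]
  rw [abs_of_pos this]

/-- Shape derivative of a volume objective: for bounded measurable `Ω ⊂ ℝᵈ`, `g : ℝᵈ → ℝ`
continuously differentiable and `V` a `C¹` compactly supported vector field, the map
`t ↦ ∫_{(I+tV)(Ω)} g` is differentiable at `0` with derivative
`∫_Ω (g div V + ⟨∇g, V⟩) = ∫_Ω div (g V)`. -/
theorem stmt_11 (d : ℕ) (Ω : Set (EuclideanSpace ℝ (Fin d)))
    (hΩm : MeasurableSet Ω) (hΩb : Bornology.IsBounded Ω)
    (g : EuclideanSpace ℝ (Fin d) → ℝ) (hg : ContDiff ℝ 1 g)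
    (V : EuclideanSpace ℝ (Fin d) → EuclideanSpace ℝ (Fin d))
    (hV : ContDiff ℝ 1 V) (hVc : HasCompactSupport V) :
    HasDerivAt (fun t : ℝ => ∫ y in (fun x => x + t • V x) '' Ω, g y)
      (∫ x in Ω, g x * LinearMap.trace ℝ (EuclideanSpace ℝ (Fin d))
          (fderiv ℝ V x : EuclideanSpace ℝ (Fin d) →ₗ[ℝ] EuclideanSpace ℝ (Fin d)) +
        ⟪gradient g x, V x⟫) 0 ∧
    (∫ x in Ω, g x * LinearMap.trace ℝ (EuclideanSpace ℝ (Fin d))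
          (fderiv ℝ V x : EuclideanSpace ℝ (Fin d) →ₗ[ℝ] EuclideanSpace ℝ (Fin d)) +
        ⟪gradient g x, V x⟫) =
      ∫ x in Ω, LinearMap.trace ℝ (EuclideanSpace ℝ (Fin d))
        (fderiv ℝ (fun y => g y • V y) x :
          EuclideanSpace ℝ (Fin d) →ₗ[ℝ] EuclideanSpace ℝ (Fin d)) := by
  refine ⟨hasDerivAt_integral_image_add_smul hΩm hΩb hg hV hVc, ?_⟩
  simp only [trace_fderiv_smul_eq (hg.differentiable one_ne_zero _)
    (hV.differentiable one_ne_zero _)]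
end

section
/- Let Ω ⊂ ℝᵈ be a bounded measurable set, g : ℝᵈ → ℝ twice continuously differentiable with bounded derivatives, and V, W : ℝᵈ → ℝᵈ continuously differentiable vector fields with compact support. Define for small s, t the function F(s,t) := ∫_Ω det(1 + s·DV(x) + t·DW(x)) · g(x + sV(x) + tW(x)) dx. Then the mixed second derivative (∂²/∂s∂t)|_{s=t=0} F exists and equals ∫_Ω [ g·( div V · div W − tr(DV·DW) ) + ⟨∇g, V⟩·div W + ⟨∇g, W⟩·div V + ⟨V, (Hess g) W⟩ ] dx. -/
open Matrix MeasureTheory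

attribute [local instance] Matrix.normedAddCommGroup

theorem hasDerivAt_add_smul {E : Type*} [NormedAddCommGroup E] [NormedSpace ℝ E]
    (z v : E) (s : ℝ) : HasDerivAt (fun s : ℝ => z + s • v) v s := by
  simpa using ((hasDerivAt_id s).smul_const v).const_add z

theorem hasDerivAt_clm_comp_add_smul {E F : Type*} [NormedAddCommGroup E] [NormedSpace ℝ E]
    [NormedAddCommGroup F] [NormedSpace ℝ F] {K : E → E →L[ℝ] F} (hK : Differentiable ℝ K)
    (z a b : E) : HasDerivAt (fun s : ℝ => K (z + s • a) b) (fderiv ℝ K z a b) 0 := by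
  have h := (hK (z + (0 : ℝ) • a)).hasFDerivAt.comp_hasDerivAt 0 (hasDerivAt_add_smul z a 0)
  rw [zero_smul, add_zero] at h
  exact (ContinuousLinearMap.apply ℝ F b).hasFDerivAt.comp_hasDerivAt (0 : ℝ) h

section ParametricIntegral

variable {X : Type*} [PseudoMetricSpace X] [ProperSpace X] [MeasurableSpace X]
  [OpensMeasurableSpace X]

/-- Differentiation under the integral sign over a bounded set, for a jointly continuous
derivative. -/
theorem hasDerivAt_setIntegral_of_continuous {μ : Measure X} [IsFiniteMeasureOnCompacts μ]
    {Ω : Set X} (hΩm : MeasurableSet Ω) (hΩb : Bornology.IsBounded Ω)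
    {f f' : ℝ → X → ℝ} (hf : ∀ s, Continuous (f s))
    (hf' : Continuous (Function.uncurry f'))
    (hd : ∀ s x, HasDerivAt (fun s => f s x) (f' s x) s) (s₀ : ℝ) :
    HasDerivAt (fun s => ∫ x in Ω, f s x ∂μ) (∫ x in Ω, f' s₀ x ∂μ) s₀ := by
  have hK : IsCompact (closure Ω) := hΩb.isCompact_closure
  obtain ⟨C, hC⟩ := ((isCompact_closedBall s₀ 1).prod hK).exists_bound_of_continuousOn
    hf'.continuousOn
  have hint (u : X → ℝ) (hu : Continuous u) : IntegrableOn u Ω μ :=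
    (hu.continuousOn.integrableOn_compact' hK isClosed_closure.measurableSet).mono_set
      subset_closure
  refine (hasDerivAt_integral_of_dominated_loc_of_deriv_le
    (Metric.closedBall_mem_nhds s₀ one_pos)
    (.of_forall fun s => (hint _ (hf s)).aestronglyMeasurable) (hint _ (hf s₀))
    (hint (f' s₀) (hf'.comp (Continuous.prodMk_right s₀))).aestronglyMeasurable
    (bound := fun _ => C) ?_ (hint _ continuous_const) (.of_forall fun x s _ => hd s x)).2
  filter_upwards [ae_restrict_mem hΩm] with x hx s hs
  exact hC (s, x) ⟨hs, subset_closure hx⟩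

/-- The mixed second derivative of `∫_Ω H(p + s a + t b)` for a `C²` function `H`. -/
theorem hasDerivAt_deriv_setIntegral_comp_add_smul {μ : Measure X}
    [IsFiniteMeasureOnCompacts μ] {Z : Type*} [NormedAddCommGroup Z] [NormedSpace ℝ Z]
    {Ω : Set X} (hΩm : MeasurableSet Ω) (hΩb : Bornology.IsBounded Ω)
    {H : Z → ℝ} (hH : ContDiff ℝ 2 H) {p a b : X → Z}
    (hp : Continuous p) (ha : Continuous a) (hb : Continuous b) :
    HasDerivAt (fun s : ℝ => deriv (fun t : ℝ => ∫ x in Ω, H (p x + s • a x + t • b x) ∂μ) 0)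
      (∫ x in Ω, fderiv ℝ (fderiv ℝ H) (p x) (a x) (b x) ∂μ) 0 := by
  have hH1 : ContDiff ℝ 1 (fderiv ℝ H) := hH.fderiv_right (by norm_num)
  have hfirst (s : ℝ) : deriv (fun t : ℝ => ∫ x in Ω, H (p x + s • a x + t • b x) ∂μ) 0 =
      ∫ x in Ω, fderiv ℝ H (p x + s • a x) (b x) ∂μ := by
    have h := hasDerivAt_setIntegral_of_continuous (μ := μ) hΩm hΩb
      (f := fun t x => H (p x + s • a x + t • b x))
      (f' := fun t x => fderiv ℝ H (p x + s • a x + t • b x) (b x))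
      (fun t => hH.continuous.comp (by fun_prop))
      ((hH1.continuous.comp
        (f := fun y : ℝ × X => p y.2 + s • a y.2 + y.1 • b y.2) (by fun_prop)).clm_apply
        (hb.comp continuous_snd))
      (fun t x => ((hH.differentiable two_ne_zero) _).hasFDerivAt.comp_hasDerivAt t
        (hasDerivAt_add_smul _ _ t)) 0
    simpa using h.deriv
  simp only [hfirst]
  have h := hasDerivAt_setIntegral_of_continuous (μ := μ) hΩm hΩb
    (f := fun s x => fderiv ℝ H (p x + s • a x) (b x))
    (f' := fun s x => fderiv ℝ (fderiv ℝ H) (p x + s • a x) (a x) (b x))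
    (fun s => (hH1.continuous.comp (f := fun x : X => p x + s • a x) (by fun_prop)).clm_apply hb)
    ((((hH1.continuous_fderiv one_ne_zero).comp
        (f := fun y : ℝ × X => p y.2 + y.1 • a y.2) (by fun_prop)).clm_apply
        (ha.comp continuous_snd)).clm_apply (hb.comp continuous_snd))
    (fun s x => by
      have h1 := ((hH1.differentiable one_ne_zero) (p x + s • a x)).hasFDerivAt.comp_hasDerivAt s
        (hasDerivAt_add_smul _ _ s)
      simpa using h1.clm_apply (hasDerivAt_const s (b x))) 0
  simpa using h

end ParametricIntegral

section Gradient

variable {n : Type*} [Fintype n] {g : (n → ℝ) → ℝ} {Gg : (n → ℝ) → (n → ℝ)}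
  {Hg : (n → ℝ) → Matrix n n ℝ}

theorem hasDerivAt_comp_add_smul_of_gradient (hg : Differentiable ℝ g)
    (hGg : ∀ x h, fderiv ℝ g x h = Gg x ⬝ᵥ h) (y v : n → ℝ) :
    HasDerivAt (fun s : ℝ => g (y + s • v)) (Gg y ⬝ᵥ v) 0 := by
  have h := (hg (y + (0 : ℝ) • v)).hasFDerivAt.comp_hasDerivAt 0 (hasDerivAt_add_smul y v 0)
  simpa [hGg, Function.comp_def] using h

theorem differentiable_gradient [DecidableEq n] (hg : ContDiff ℝ 2 g)
    (hGg : ∀ x h, fderiv ℝ g x h = Gg x ⬝ᵥ h) : Differentiable ℝ Gg := by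
  have hG : Gg = fun x i => fderiv ℝ g x (Pi.single i 1) := by
    funext x i
    simp [hGg]
  rw [hG]
  have h1 : ContDiff ℝ 1 (fderiv ℝ g) := hg.fderiv_right (by norm_num)
  exact differentiable_pi.2 fun i x =>
    ((h1.differentiable one_ne_zero) x).clm_apply (differentiableAt_const _)

theorem hasDerivAt_gradient_comp_add_smul_dotProduct (hG : Differentiable ℝ Gg)
    (hHg : ∀ x h, fderiv ℝ Gg x h = Hg x *ᵥ h) (y v w : n → ℝ) :
    HasDerivAt (fun s : ℝ => Gg (y + s • v) ⬝ᵥ w) ((Hg y *ᵥ v) ⬝ᵥ w) 0 := by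
  have h := (hG (y + (0 : ℝ) • v)).hasFDerivAt.comp_hasDerivAt 0 (hasDerivAt_add_smul y v 0)
  simp only [hHg, zero_smul, add_zero] at h
  simp only [dotProduct]
  exact HasDerivAt.fun_sum fun i _ => (hasDerivAt_pi.1 h i).mul_const (w i)

end Gradient

section Determinant

variable {n : Type*} [Fintype n] [DecidableEq n]

theorem contDiff_matrix_det {k : WithTop ℕ∞} :
    ContDiff ℝ k (fun M : n → n → ℝ => (Matrix.of M).det) := by
  simp only [Matrix.det_apply, Matrix.of_apply]
  refine ContDiff.sum fun σ _ => ContDiff.const_smul _ (contDiff_prod fun i _ => ?_)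
  exact contDiff_apply_apply ℝ ℝ (σ i) i

/-- Jacobi's formula along a line. -/
theorem hasDerivAt_det_add_smul (M B : Matrix n n ℝ) :
    HasDerivAt (fun t : ℝ => (M + t • B).det) (M.adjugate * B).trace 0 := by
  let D : ContinuousMultilinearMap ℝ (fun _ : n => n → ℝ) ℝ :=
    { (Matrix.detRowAlternating : (n → ℝ) [⋀^n]→ₗ[ℝ] ℝ).toMultilinearMap with
      cont := Continuous.matrix_det (continuous_id : Continuous fun M : Matrix n n ℝ => M) }
  have hline : HasDerivAt (fun t : ℝ => Matrix.of.symm M + t • Matrix.of.symm B)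
      (Matrix.of.symm B) 0 := hasDerivAt_add_smul _ _ 0
  have h := (D.hasFDerivAt (Matrix.of.symm M + (0 : ℝ) • Matrix.of.symm B)).comp_hasDerivAt
    (0 : ℝ) hline
  rw [ContinuousMultilinearMap.linearDeriv_apply, zero_smul, add_zero] at h
  have hrow (i : n) : D (Function.update (Matrix.of.symm M) i (Matrix.of.symm B i)) =
      (M.updateRow i (B i)).det := rfl
  refine h.congr_deriv ?_
  simp only [hrow, ← Matrix.cramer_transpose_apply, Matrix.cramer_eq_adjugate_mulVec,
    Matrix.trace, Matrix.diag_apply, Matrix.mul_apply, Matrix.mulVec, dotProduct,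
    ← Matrix.adjugate_transpose, Matrix.transpose_apply]
  rw [Finset.sum_comm]

/-- The derivative of `s ↦ adj (1 + s A)` at `0`. -/
theorem hasDerivAt_adjugate_one_add_smul (A : Matrix n n ℝ) :
    HasDerivAt (fun s : ℝ => (1 + s • A).adjugate) (A.trace • (1 : Matrix n n ℝ) - A) 0 := by
  have hdiff (i j : n) : DifferentiableAt ℝ (fun s : ℝ => (1 + s • A).adjugate i j) 0 := by
    simp only [Matrix.adjugate_apply]
    refine ((contDiff_matrix_det (k := 1)).differentiable one_ne_zero _).comp (0 : ℝ)
      (g := fun M : n → n → ℝ => (Matrix.of M).det)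
      (f := fun s : ℝ => Matrix.of.symm ((1 + s • A).updateRow j (Pi.single i 1))) ?_
    refine differentiableAt_pi.2 fun k => differentiableAt_pi.2 fun l => ?_
    simp only [Matrix.of_symm_apply, Matrix.updateRow_apply]
    split_ifs
    · fun_prop
    · simp only [Matrix.add_apply, Matrix.smul_apply, smul_eq_mul]
      fun_prop
  have hentry (i j : n) : HasDerivAt (fun s : ℝ => (1 + s • A) i j) (A i j) 0 := by
    simpa using ((hasDerivAt_id (0 : ℝ)).mul_const (A i j)).const_add ((1 : Matrix n n ℝ) i j)
  refine hasDerivAt_pi.2 fun i => hasDerivAt_pi.2 fun j => ?_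
  have h1 := HasDerivAt.fun_sum (u := Finset.univ) fun k (_ : k ∈ Finset.univ) =>
    (hdiff i k).hasDerivAt.mul (hentry k j)
  have h2 := (hasDerivAt_det_add_smul 1 A).mul_const ((1 : Matrix n n ℝ) i j)
  have heq : (fun s : ℝ => ∑ k, (1 + s • A).adjugate i k * (1 + s • A) k j) =
      fun s : ℝ => (1 + s • A).det * (1 : Matrix n n ℝ) i j := by
    funext s
    rw [← Matrix.mul_apply, Matrix.adjugate_mul, Matrix.smul_apply, smul_eq_mul]
  have h := h1.unique (heq ▸ h2)
  convert (hdiff i j).hasDerivAt using 1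
  simp [Matrix.one_apply, Finset.sum_add_distrib] at h
  simp [Matrix.one_apply]
  linarith

/-- The weighted determinant `(M, y) ↦ det M * g y`, on the normed space underlying the product. -/
def detMul (g : (n → ℝ) → ℝ) (z : (n → n → ℝ) × (n → ℝ)) : ℝ :=
  (Matrix.of z.1).det * g z.2

theorem ContDiff.detMul {k : WithTop ℕ∞} {g : (n → ℝ) → ℝ} (hg : ContDiff ℝ k g) :
    ContDiff ℝ k (detMul g) :=
  (contDiff_matrix_det.comp contDiff_fst).mul (hg.comp contDiff_snd)

variable {g : (n → ℝ) → ℝ} {Gg : (n → ℝ) → (n → ℝ)} {Hg : (n → ℝ) → Matrix n n ℝ}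

theorem fderiv_detMul_apply (hg : ContDiff ℝ 1 g)
    (hGg : ∀ x h, fderiv ℝ g x h = Gg x ⬝ᵥ h) (M B : Matrix n n ℝ) (y w : n → ℝ) :
    fderiv ℝ (detMul g) (Matrix.of.symm M, y) (Matrix.of.symm B, w) =
      (M.adjugate * B).trace * g y + M.det * (Gg y ⬝ᵥ w) := by
  have h := (hg.detMul.differentiable one_ne_zero
    ((Matrix.of.symm M, y) + (0 : ℝ) • (Matrix.of.symm B, w))).hasFDerivAt.comp_hasDerivAt 0
      (hasDerivAt_add_smul (Matrix.of.symm M, y) (Matrix.of.symm B, w) 0)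
  have h' := (hasDerivAt_det_add_smul M B).mul
    (hasDerivAt_comp_add_smul_of_gradient (hg.differentiable one_ne_zero) hGg y w)
  simpa only [zero_smul, add_zero] using h.unique h'

theorem fderiv_fderiv_detMul_apply (hg : ContDiff ℝ 2 g)
    (hGg : ∀ x h, fderiv ℝ g x h = Gg x ⬝ᵥ h) (hHg : ∀ x h, fderiv ℝ Gg x h = Hg x *ᵥ h)
    (A B : Matrix n n ℝ) (y v w : n → ℝ) :
    fderiv ℝ (fderiv ℝ (detMul g)) (Matrix.of.symm 1, y) (Matrix.of.symm A, v)
        (Matrix.of.symm B, w) =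
      g y * (A.trace * B.trace - (A * B).trace) + (Gg y ⬝ᵥ v) * B.trace +
        (Gg y ⬝ᵥ w) * A.trace + (Hg y *ᵥ v) ⬝ᵥ w := by
  have hd : Differentiable ℝ (fderiv ℝ (detMul g)) :=
    (hg.detMul.fderiv_right (m := 1) (by norm_num)).differentiable one_ne_zero
  have h := hasDerivAt_clm_comp_add_smul hd (Matrix.of.symm 1, y) (Matrix.of.symm A, v)
    (Matrix.of.symm B, w)
  have hadj : HasDerivAt (fun s : ℝ => ((1 + s • A).adjugate * B).trace)
      ((A.trace • (1 : Matrix n n ℝ) - A) * B).trace 0 := by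
    simp only [Matrix.trace, Matrix.diag_apply, Matrix.mul_apply]
    exact HasDerivAt.fun_sum fun i _ => HasDerivAt.fun_sum fun k _ =>
      (hasDerivAt_pi.1 (hasDerivAt_pi.1 (hasDerivAt_adjugate_one_add_smul A) i) k).mul_const _
  have h' := (hadj.fun_mul (hasDerivAt_comp_add_smul_of_gradient
      (hg.differentiable two_ne_zero) hGg y v)).fun_add
    ((hasDerivAt_det_add_smul 1 A).fun_mul
      (hasDerivAt_gradient_comp_add_smul_dotProduct (differentiable_gradient hg hGg) hHg y v w))
  have hfirst (s : ℝ) : fderiv ℝ (detMul g)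
      ((Matrix.of.symm 1, y) + s • (Matrix.of.symm A, v)) (Matrix.of.symm B, w) =
      ((1 + s • A).adjugate * B).trace * g (y + s • v) +
        (1 + s • A).det * (Gg (y + s • v) ⬝ᵥ w) :=
    fderiv_detMul_apply (hg.of_le one_le_two) hGg (1 + s • A) B (y + s • v) w
  simp only [hfirst] at h
  rw [h.unique h']
  simp [sub_mul]
  ring

/-- The matrix representing the derivative of a `C¹` vector field is continuous. -/
theorem continuous_of_fderiv_eq_mulVec {U : (n → ℝ) → (n → ℝ)} {DU : (n → ℝ) → Matrix n n ℝ}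
    (hU : ContDiff ℝ 1 U) (hDU : ∀ x h, fderiv ℝ U x h = DU x *ᵥ h) : Continuous DU := by
  refine continuous_pi fun i => continuous_pi fun j => ?_
  have h : (fun x => DU x i j) = fun x => fderiv ℝ U x (Pi.single j 1) i := by
    funext x
    simp [hDU]
  rw [h]
  exact (continuous_apply i).comp
    ((hU.continuous_fderiv one_ne_zero).clm_apply continuous_const)

end Determinant

/-- Linear second shape derivative of a volume objective: with gradient `Gg` and Hessian `Hg`
of the `C²` function `g` (with bounded derivatives), Jacobians `DV, DW` of the `C¹` compactly
supported fields `V, W`, the mixed second derivative at `(0,0)` of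
`F(s,t) = ∫_Ω det(1 + s DV + t DW) g(x + sV + tW)` exists and equals
`∫_Ω [g (div V div W − tr(DV DW)) + ⟨∇g,V⟩ div W + ⟨∇g,W⟩ div V + ⟨V, Hess g W⟩]`. -/
theorem stmt_16 (d : ℕ) (Ω : Set (Fin d → ℝ))
    (hΩm : MeasurableSet Ω) (hΩb : Bornology.IsBounded Ω)
    (g : (Fin d → ℝ) → ℝ) (Gg : (Fin d → ℝ) → (Fin d → ℝ))
    (Hg : (Fin d → ℝ) → Matrix (Fin d) (Fin d) ℝ)
    (hg : ContDiff ℝ 2 g)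
    (hGg : ∀ x h, fderiv ℝ g x h = Gg x ⬝ᵥ h)
    (hHg : ∀ x h, fderiv ℝ Gg x h = Hg x *ᵥ h)
    (hgb : ∃ M : ℝ, ∀ x, ‖Gg x‖ ≤ M ∧ ‖Hg x‖ ≤ M)
    (V W : (Fin d → ℝ) → (Fin d → ℝ))
    (DV DW : (Fin d → ℝ) → Matrix (Fin d) (Fin d) ℝ)
    (hV : ContDiff ℝ 1 V) (hVc : HasCompactSupport V)
    (hW : ContDiff ℝ 1 W) (hWc : HasCompactSupport W)
    (hDV : ∀ x h, fderiv ℝ V x h = DV x *ᵥ h)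
    (hDW : ∀ x h, fderiv ℝ W x h = DW x *ᵥ h) :
    HasDerivAt (fun s : ℝ => deriv (fun t : ℝ =>
        ∫ x in Ω, (1 + s • DV x + t • DW x).det * g (x + s • V x + t • W x)) 0)
      (∫ x in Ω,
        g x * ((DV x).trace * (DW x).trace - (DV x * DW x).trace) +
          (Gg x ⬝ᵥ V x) * (DW x).trace + (Gg x ⬝ᵥ W x) * (DV x).trace +
          V x ⬝ᵥ (Hg x *ᵥ W x)) 0 := by
  have hmain := hasDerivAt_deriv_setIntegral_comp_add_smul (μ := volume) hΩm hΩb hg.detMul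
    (p := fun x => (Matrix.of.symm 1, x)) (a := fun x => (Matrix.of.symm (DV x), V x))
    (b := fun x => (Matrix.of.symm (DW x), W x)) (by fun_prop)
    ((continuous_of_fderiv_eq_mulVec hV hDV).prodMk hV.continuous)
    ((continuous_of_fderiv_eq_mulVec hW hDW).prodMk hW.continuous)
  refine HasDerivAt.congr_deriv hmain (integral_congr_ae (.of_forall fun x => ?_))
  have hsymm : IsSymmSndFDerivAt ℝ (detMul g) (Matrix.of.symm 1, x) :=
    hg.detMul.contDiffAt.isSymmSndFDerivAt (by simp)
  have h := hsymm (Matrix.of.symm (DV x), V x) (Matrix.of.symm (DW x), W x)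
  rw [fderiv_fderiv_detMul_apply hg hGg hHg (DW x)] at h
  refine h.trans ?_
  rw [dotProduct_comm (Hg x *ᵥ W x), Matrix.trace_mul_comm (DW x)]
  ring
end
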